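/- Let R be a ring with finite stable rank sr(R). If N is a right R-module such that N ⊕ R ≅ R^{n+1} and n ≥ sr(R), then N ≅ R^n. -/

import Mathlib

open MulOpposite in
/-- The right-linear map `R → M` sending `1` to `m`. -/
def rightSpanSingleton {R M : Type*} [Ring R] [AddCommGroup M] [Module Rᵐᵒᵖ M] (m : M) :
    R →ₗ[Rᵐᵒᵖ] M where
  toFun y := op y • m
  map_add' x y := by rw [op_add, add_smul]
  map_smul' c y := by rw [smul_eq_mul_unop, op_mul, op_unop, mul_smul, RingHom.id_apply]

@[simp]
theorem rightSpanSingleton_apply {R M : Type*} [Ring R] [AddCommGroup M] [Module Rᵐᵒᵖ M]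
    (m : M) (y : R) : rightSpanSingleton m y = MulOpposite.op y • m :=
  rfl

/-- The shear `(x, y) ↦ (x + m y, y)` of `M × R`. -/
def shearFst {R M : Type*} [Ring R] [AddCommGroup M] [Module Rᵐᵒᵖ M] (m : M) :
    (M × R) ≃ₗ[Rᵐᵒᵖ] (M × R) :=
  LinearEquiv.prodComm Rᵐᵒᵖ M R ≪≫ₗ
    (LinearEquiv.refl Rᵐᵒᵖ R).skewProd (LinearEquiv.refl Rᵐᵒᵖ M) (rightSpanSingleton m) ≪≫ₗ
    LinearEquiv.prodComm Rᵐᵒᵖ R M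

@[simp]
theorem shearFst_apply {R M : Type*} [Ring R] [AddCommGroup M] [Module Rᵐᵒᵖ M]
    (m : M) (p : M × R) : shearFst m p = (p.1 + MulOpposite.op p.2 • m, p.2) :=
  rfl

/-- If `w` is mapped to `1` by some functional, an automorphism of `M × R` takes `(w, t)` to
`(0, 1)`. -/
theorem exists_linearEquiv_prod_apply_eq {R M : Type*} [Ring R] [AddCommGroup M]
    [Module Rᵐᵒᵖ M] (f : M →ₗ[Rᵐᵒᵖ] R) {w : M} (hw : f w = 1) (t : R) :
    ∃ e : (M × R) ≃ₗ[Rᵐᵒᵖ] (M × R), e (w, t) = (0, 1) := by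
  refine ⟨(LinearEquiv.refl Rᵐᵒᵖ M).skewProd (LinearEquiv.refl Rᵐᵒᵖ R)
    (rightSpanSingleton (1 - t) ∘ₗ f) ≪≫ₗ shearFst (-w), ?_⟩
  simp [LinearEquiv.skewProd_apply, hw]

/-- If `e : N × R ≃ M × R` fixes `(0, 1)`, the map `M → N` induced by `e.symm` is a section of the
map `N → M` induced by `e`. -/
theorem fst_apply_fst_symm_apply {R M N : Type*} [Ring R] [AddCommGroup M] [Module Rᵐᵒᵖ M]
    [AddCommGroup N] [Module Rᵐᵒᵖ N] (e : (N × R) ≃ₗ[Rᵐᵒᵖ] (M × R)) (he : e (0, 1) = (0, 1))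
    (y : M) : (e ((e.symm (y, 0)).1, 0)).1 = y := by
  have key : ((e.symm (y, 0)).1, (0 : R)) =
      e.symm (y, 0) - MulOpposite.op (e.symm (y, 0)).2 • ((0 : N), (1 : R)) := by
    ext <;> simp
  rw [key, map_sub, map_smul, he]
  simp

/-- An isomorphism `N × R ≃ M × R` fixing `(0, 1)` yields an isomorphism `N ≃ M`. -/
theorem nonempty_linearEquiv_of_prod {R M N : Type*} [Ring R] [AddCommGroup M] [Module Rᵐᵒᵖ M]
    [AddCommGroup N] [Module Rᵐᵒᵖ N] (e : (N × R) ≃ₗ[Rᵐᵒᵖ] (M × R)) (he : e (0, 1) = (0, 1)) :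
    Nonempty (N ≃ₗ[Rᵐᵒᵖ] M) := by
  have he' : e.symm (0, 1) = (0, 1) := by rw [← he, e.symm_apply_apply]
  exact ⟨LinearEquiv.ofLinearMap
    (LinearMap.fst Rᵐᵒᵖ M R ∘ₗ e.toLinearMap ∘ₗ LinearMap.inl Rᵐᵒᵖ N R)
    (LinearMap.fst Rᵐᵒᵖ N R ∘ₗ e.symm.toLinearMap ∘ₗ LinearMap.inl Rᵐᵒᵖ M R)
    (LinearMap.ext fun y => fst_apply_fst_symm_apply e he y)
    (LinearMap.ext fun x => fst_apply_fst_symm_apply e.symm he' x)⟩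

/-- Splitting off the last coordinate of a vector, as a right-linear equivalence. -/
def initLastEquiv (R : Type*) [Ring R] (n : ℕ) :
    (Fin (n + 1) → R) ≃ₗ[Rᵐᵒᵖ] ((Fin n → R) × R) where
  toFun v := (fun i => v i.castSucc, v (Fin.last n))
  invFun p := Fin.snoc p.1 p.2
  map_add' _ _ := rfl
  map_smul' _ _ := rfl
  left_inv v := Fin.snoc_init_self v
  right_inv p := by simp


/-- A vector `v ∈ R^m` (a row of a free right `R`-module) is *unimodular* if there is a
right-module homomorphism `f : R^m → R` with `f v = 1`. -/
def IsUnimodular (R : Type*) [Ring R] {m : ℕ} (v : Fin m → R) : Prop :=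
  ∃ f : (Fin m → R) →ₗ[Rᵐᵒᵖ] R, f v = 1

/-- Bass' stable range condition `(SR_n)`: for every `m + 1 ≥ n` and every unimodular
vector `(x_1, …, x_{m+1}) ∈ R^{m+1}` there are `r_1, …, r_m ∈ R` such that
`(x_1 + r_1 x_{m+1}, …, x_m + r_m x_{m+1}) ∈ R^m` is unimodular. -/
def SatisfiesSR (R : Type*) [Ring R] (n : ℕ) : Prop :=
  ∀ m : ℕ, n ≤ m + 1 → ∀ v : Fin (m + 1) → R, IsUnimodular R v →
    ∃ r : Fin m → R,
      IsUnimodular R (fun i : Fin m => v i.castSucc + r i * v (Fin.last m))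

/-- The stable rank `sr(R) = min {k | R satisfies (SR_{k+1})}`. -/
noncomputable def stableRank (R : Type*) [Ring R] : ℕ :=
  sInf {k : ℕ | SatisfiesSR R (k + 1)}

/-- **Cancellation of free summands below the stable rank** (Randal-Williams–Wahl,
Proposition 5.2; Bass).  Let `R` be a ring of finite stable rank `sr(R)`.  If `N` is a
right `R`-module with `N ⊕ R ≅ R^{n+1}` and `n ≥ sr(R)`, then `N ≅ R^n`. -/
theorem free_summand_cancellation
    (R : Type*) [Ring R] (hfin : {k : ℕ | SatisfiesSR R (k + 1)}.Nonempty)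
    (N : Type*) [AddCommGroup N] [Module Rᵐᵒᵖ N] (n : ℕ)
    (hn : stableRank R ≤ n)
    (h : Nonempty ((N × R) ≃ₗ[Rᵐᵒᵖ] (Fin (n + 1) → R))) :
    Nonempty (N ≃ₗ[Rᵐᵒᵖ] (Fin n → R)) := by
  obtain ⟨φ⟩ := h
  have hSR : SatisfiesSR R (stableRank R + 1) := Nat.sInf_mem hfin
  obtain ⟨r, f, hf⟩ := hSR n (by lia) (φ (0, 1))
    ⟨LinearMap.snd Rᵐᵒᵖ N R ∘ₗ φ.symm.toLinearMap, by simp⟩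
  obtain ⟨e, he⟩ := exists_linearEquiv_prod_apply_eq f hf (φ (0, 1) (Fin.last n))
  exact nonempty_linearEquiv_of_prod (φ ≪≫ₗ initLastEquiv R n ≪≫ₗ shearFst r ≪≫ₗ e) he
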